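/- Let (φ,ψ) ∈ V̂ × V̂ with adjoint states p, p̂, and let δφ = B*p − B̂*p̂ and δψ = C*p + Ĉ*p̂ − E*(γ u(φ,ψ) + E û(φ,ψ) − 2Eψ) be the steepest-descent increments; set δu = A⁻¹(Bδφ + Cδψ) and δû = Â⁻¹(−B̂δφ + Ĉδψ). If D := ‖γδu − Eδψ‖²_H + ‖Eδû − Eδψ‖²_H > 0, then the function ζ ↦ J(φ+ζδφ, ψ+ζδψ) has the unique global minimizer ζ = −(‖δφ‖²_{V̂} + ‖δψ‖²_{V̂}) / D. -/

import Mathlib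

open ContinuousLinearMap
open scoped RealInnerProductSpace

variable {V Vh H : Type*}
  [NormedAddCommGroup V] [InnerProductSpace ℝ V] [CompleteSpace V]
  [NormedAddCommGroup Vh] [InnerProductSpace ℝ Vh] [CompleteSpace Vh]
  [NormedAddCommGroup H] [InnerProductSpace ℝ H] [CompleteSpace H]

/-- The state `u(φ,ψ) = A⁻¹(Bφ + Cψ + F)`. -/
noncomputable def stateU (A : V ≃L[ℝ] V) (B C : Vh →L[ℝ] V) (F : V) (φ ψ : Vh) : V :=
  A.symm (B φ + C ψ + F)

/-- The state `û(φ,ψ) = Â⁻¹(−B̂φ + Ĉψ + G)`. -/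
noncomputable def stateUh (Ah : Vh ≃L[ℝ] Vh) (Bh Ch : Vh →L[ℝ] Vh) (G : Vh) (φ ψ : Vh) : Vh :=
  Ah.symm (-(Bh φ) + Ch ψ + G)

/-- The cost functional `J(φ,ψ) = ½‖γu − Eψ‖² + ½‖Eû − Eψ‖²`. -/
noncomputable def costJ (γ : V →L[ℝ] H) (E : Vh →L[ℝ] H) (A : V ≃L[ℝ] V) (Ah : Vh ≃L[ℝ] Vh)
    (B C : Vh →L[ℝ] V) (Bh Ch : Vh →L[ℝ] Vh) (F : V) (G : Vh) (φ ψ : Vh) : ℝ :=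
  (1 / 2) * ‖γ (stateU A B C F φ ψ) - E ψ‖ ^ 2
    + (1 / 2) * ‖E (stateUh Ah Bh Ch G φ ψ) - E ψ‖ ^ 2

theorem inner_apply_eq_of_adjoint_eq (γ : V →L[ℝ] H) (A : V ≃L[ℝ] V) (p : V) (a : H)
    (h : ContinuousLinearMap.adjoint (A : V →L[ℝ] V) p = ContinuousLinearMap.adjoint γ a)
    (w : V) : ⟪a, γ (A.symm w)⟫ = ⟪p, w⟫ := by
  rw [← ContinuousLinearMap.adjoint_inner_left, ← h, ContinuousLinearMap.adjoint_inner_left]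
  simp

section Line

variable {X Y Z : Type*} [NormedAddCommGroup X] [InnerProductSpace ℝ X]
  [NormedAddCommGroup Y] [InnerProductSpace ℝ Y] [NormedAddCommGroup Z] [InnerProductSpace ℝ Z]

theorem stateU_add_smul (A : X ≃L[ℝ] X) (B C : Y →L[ℝ] X) (F : X) (φ ψ δφ δψ : Y) (ζ : ℝ) :
    stateU A B C F (φ + ζ • δφ) (ψ + ζ • δψ)
      = stateU A B C F φ ψ + ζ • A.symm (B δφ + C δψ) := by
  simp only [stateU, map_add, map_smul, smul_add]
  abel

theorem stateUh_add_smul (Ah : Y ≃L[ℝ] Y) (Bh Ch : Y →L[ℝ] Y) (G : Y)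
    (φ ψ δφ δψ : Y) (ζ : ℝ) :
    stateUh Ah Bh Ch G (φ + ζ • δφ) (ψ + ζ • δψ)
      = stateUh Ah Bh Ch G φ ψ + ζ • Ah.symm (-(Bh δφ) + Ch δψ) := by
  simp only [stateUh, map_add, map_neg, map_smul, smul_add, smul_neg, neg_add]
  abel

theorem norm_add_smul_sq (a b : Z) (ζ : ℝ) :
    ‖a + ζ • b‖ ^ 2 = ‖a‖ ^ 2 + 2 * ζ * ⟪a, b⟫ + ζ ^ 2 * ‖b‖ ^ 2 := by
  rw [norm_add_sq_real, real_inner_smul_right, norm_smul, mul_pow, Real.norm_eq_abs, sq_abs]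
  ring

/-- The cost functional along a line is a quadratic polynomial in the step. -/
theorem costJ_add_smul (γ : X →L[ℝ] Z) (E : Y →L[ℝ] Z) (A : X ≃L[ℝ] X) (Ah : Y ≃L[ℝ] Y)
    (B C : Y →L[ℝ] X) (Bh Ch : Y →L[ℝ] Y) (F : X) (G : Y) (φ ψ δφ δψ : Y) (ζ : ℝ) :
    costJ γ E A Ah B C Bh Ch F G (φ + ζ • δφ) (ψ + ζ • δψ)
      = costJ γ E A Ah B C Bh Ch F G φ ψ
        + ζ * (⟪γ (stateU A B C F φ ψ) - E ψ, γ (A.symm (B δφ + C δψ)) - E δψ⟫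
          + ⟪E (stateUh Ah Bh Ch G φ ψ) - E ψ, E (Ah.symm (-(Bh δφ) + Ch δψ)) - E δψ⟫)
        + ζ ^ 2 / 2 * (‖γ (A.symm (B δφ + C δψ)) - E δψ‖ ^ 2
          + ‖E (Ah.symm (-(Bh δφ) + Ch δψ)) - E δψ‖ ^ 2) := by
  have split (x y z w : Z) : x + ζ • y - (z + ζ • w) = (x - z) + ζ • (y - w) := by
    rw [smul_sub]; abel
  simp only [costJ, stateU_add_smul, stateUh_add_smul]
  rw [map_add γ, map_add E, map_add E, map_smul γ, map_smul E, map_smul E, split, split,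
    norm_add_smul_sq, norm_add_smul_sq]
  ring

end Line

/-- The directional derivative of the cost functional, expressed through the adjoint states. -/
theorem inner_residuals_eq_inner_gradient (γ : V →L[ℝ] H) (E : Vh →L[ℝ] H)
    (A : V ≃L[ℝ] V) (Ah : Vh ≃L[ℝ] Vh) (B C : Vh →L[ℝ] V) (Bh Ch : Vh →L[ℝ] Vh)
    (x y z : H) (p : V) (ph : Vh)
    (hp : ContinuousLinearMap.adjoint (A : V →L[ℝ] V) p
        = ContinuousLinearMap.adjoint γ (x - z))
    (hph : ContinuousLinearMap.adjoint (Ah : Vh →L[ℝ] Vh) ph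
        = ContinuousLinearMap.adjoint E (y - z)) (δφ δψ : Vh) :
    ⟪x - z, γ (A.symm (B δφ + C δψ)) - E δψ⟫
        + ⟪y - z, E (Ah.symm (-(Bh δφ) + Ch δψ)) - E δψ⟫
      = ⟪ContinuousLinearMap.adjoint B p - ContinuousLinearMap.adjoint Bh ph, δφ⟫
        + ⟪ContinuousLinearMap.adjoint C p + ContinuousLinearMap.adjoint Ch ph
          - ContinuousLinearMap.adjoint E (x + y - 2 • z), δψ⟫ := by
  rw [inner_sub_right, inner_sub_right, inner_apply_eq_of_adjoint_eq γ A p _ hp,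
    inner_apply_eq_of_adjoint_eq E Ah ph _ hph]
  simp only [inner_sub_left, inner_add_left, inner_add_right, inner_neg_right,
    ContinuousLinearMap.adjoint_inner_left, two_smul]
  ring

/-- Steepest descent step: with the steepest-descent increments
`δφ = B*p − B̂*p̂`, `δψ = C*p + Ĉ*p̂ − E*(γu + Eû − 2Eψ)`,
`δu = A⁻¹(Bδφ + Cδψ)`, `δû = Â⁻¹(−B̂δφ + Ĉδψ)`, if
`D = ‖γδu − Eδψ‖² + ‖Eδû − Eδψ‖² > 0`, then
`ζ₀ = −(‖δφ‖² + ‖δψ‖²)/D` is the unique global minimizer of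
`ζ ↦ J(φ+ζδφ, ψ+ζδψ)`. -/
theorem steepest_descent_optimal_step
    (γ : V →L[ℝ] H) (E : Vh →L[ℝ] H) (A : V ≃L[ℝ] V) (Ah : Vh ≃L[ℝ] Vh)
    (B C : Vh →L[ℝ] V) (Bh Ch : Vh →L[ℝ] Vh) (F : V) (G : Vh)
    (φ ψ : Vh) (p : V) (ph : Vh)
    (hp : ContinuousLinearMap.adjoint (A : V →L[ℝ] V) p
        = ContinuousLinearMap.adjoint γ (γ (stateU A B C F φ ψ) - E ψ))
    (hph : ContinuousLinearMap.adjoint (Ah : Vh →L[ℝ] Vh) ph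
        = ContinuousLinearMap.adjoint E (E (stateUh Ah Bh Ch G φ ψ) - E ψ))
    (δφ δψ : Vh) (δu : V) (δuh : Vh) (D ζ₀ : ℝ)
    (hδφ : δφ = ContinuousLinearMap.adjoint B p - ContinuousLinearMap.adjoint Bh ph)
    (hδψ : δψ = ContinuousLinearMap.adjoint C p + ContinuousLinearMap.adjoint Ch ph
        - ContinuousLinearMap.adjoint E
            (γ (stateU A B C F φ ψ) + E (stateUh Ah Bh Ch G φ ψ) - 2 • E ψ))
    (hδu : δu = A.symm (B δφ + C δψ))
    (hδuh : δuh = Ah.symm (-(Bh δφ) + Ch δψ))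
    (hD : D = ‖γ δu - E δψ‖ ^ 2 + ‖E δuh - E δψ‖ ^ 2)
    (hDpos : 0 < D)
    (hζ₀ : ζ₀ = -(‖δφ‖ ^ 2 + ‖δψ‖ ^ 2) / D) :
    ∀ ζ : ℝ, ζ ≠ ζ₀ →
      costJ γ E A Ah B C Bh Ch F G (φ + ζ₀ • δφ) (ψ + ζ₀ • δψ)
        < costJ γ E A Ah B C Bh Ch F G (φ + ζ • δφ) (ψ + ζ • δψ) := by
  intro ζ hζ
  have hgrad := inner_residuals_eq_inner_gradient γ E A Ah B C Bh Ch _ _ _ p ph hp hph δφ δψ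
  rw [← hδφ, ← hδψ, real_inner_self_eq_norm_sq, real_inner_self_eq_norm_sq] at hgrad
  rw [costJ_add_smul, costJ_add_smul, hgrad, ← hδu, ← hδuh, ← hD]
  have hslope : ‖δφ‖ ^ 2 + ‖δψ‖ ^ 2 = -(ζ₀ * D) := by
    rw [hζ₀]
    field_simp
  have hgap : 0 < D * (ζ - ζ₀) ^ 2 := mul_pos hDpos (sq_pos_of_ne_zero (sub_ne_zero.mpr hζ))
  rw [hslope]
  linarith
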